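/- (Configuration H(6,9)) Let Z be a set of six points in the complex projective plane ℙ² consisting of the three vertices V₁, V₂, V₃ of a triangle formed by three distinct non-concurrent lines, together with one additional point on each side of the triangle, each additional point distinct from the vertices, such that the only triples of collinear points among the six are the three triples lying on the sides of the triangle. Let I be the radical homogeneous ideal of Z. Then α̂(I) = 9/4; moreover, the first differences of the initial sequence of I are periodic with period (3,2,2,2): for every k ≥ 0 one has α(I^(4k+1)) = 9k + 3, α(I^(4k+2)) = 9k + 5, α(I^(4k+3)) = 9k + 7, and α(I^(4k+4)) = 9k + 9. -/

import Mathlib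

open scoped LinearAlgebra.Projectivization

/-- A polynomial `F` vanishes to order at least `m` at the (affine representative) point
`v`: all iterated partial derivatives of order `≤ m - 1` (i.e. of order `< m`) vanish at `v`. -/
def VanishesToOrder (m : ℕ) (F : MvPolynomial (Fin 3) ℂ) (v : Fin 3 → ℂ) : Prop :=
  ∀ k : ℕ, k < m → ∀ d : Fin k → Fin 3,
    MvPolynomial.eval v ((List.ofFn d).foldl (fun p i => MvPolynomial.pderiv i p) F) = 0

/-- The `m`-th symbolic power of the (radical) ideal of a set `Z` of points of `ℙ²`:
all polynomials vanishing to order at least `m` at every point of `Z`. -/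
def symbolicPower (Z : Set (ℙ ℂ (Fin 3 → ℂ))) (m : ℕ) : Set (MvPolynomial (Fin 3) ℂ) :=
  {F | ∀ P ∈ Z, ∀ (v : Fin 3 → ℂ) (hv : v ≠ 0),
    Projectivization.mk ℂ v hv = P → VanishesToOrder m F v}

/-- The initial degree `α` of a set of polynomials: the least `t` such that the set contains
a nonzero homogeneous polynomial of degree `t`. -/
noncomputable def initialDegree (S : Set (MvPolynomial (Fin 3) ℂ)) : ℕ :=
  sInf {t | ∃ F ∈ S, F ≠ 0 ∧ F.IsHomogeneous t}

/-- The Waldschmidt constant `α̂(I) = inf_{m ≥ 1} α(I^(m))/m` of the radical ideal of `Z`. -/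
noncomputable def waldschmidt (Z : Set (ℙ ℂ (Fin 3 → ℂ))) : ℝ :=
  ⨅ m : ℕ+, (initialDegree (symbolicPower Z (m : ℕ)) : ℝ) / ((m : ℕ) : ℝ)

/-- A (homogeneous equation of a) line in `ℙ²`: a nonzero homogeneous polynomial of degree 1. -/
def IsLine (L : MvPolynomial (Fin 3) ℂ) : Prop := L ≠ 0 ∧ L.IsHomogeneous 1

/-- The point `x ∈ ℙ²` lies on the line (or curve) with equation `L`. -/
def MemLine (L : MvPolynomial (Fin 3) ℂ) (x : ℙ ℂ (Fin 3 → ℂ)) : Prop :=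
  ∀ (v : Fin 3 → ℂ) (hv : v ≠ 0), Projectivization.mk ℂ v hv = x → MvPolynomial.eval v L = 0

/-- Three points of `ℙ²` are collinear if some line contains all of them. -/
def Collin (x y z : ℙ ℂ (Fin 3 → ℂ)) : Prop :=
  ∃ M, IsLine M ∧ MemLine M x ∧ MemLine M y ∧ MemLine M z

/-- `Z` is contained in a conic: the zero set of a nonzero homogeneous polynomial of degree 2
(possibly degenerate). -/
def ContainedInConic (Z : Set (ℙ ℂ (Fin 3 → ℂ))) : Prop :=
  ∃ F : MvPolynomial (Fin 3) ℂ, F ≠ 0 ∧ F.IsHomogeneous 2 ∧ ∀ x ∈ Z, MemLine F x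

namespace VanishesToOrder

variable {m n : ℕ} {F G : MvPolynomial (Fin 3) ℂ} {v : Fin 3 → ℂ}

theorem zero (F : MvPolynomial (Fin 3) ℂ) (v : Fin 3 → ℂ) : VanishesToOrder 0 F v :=
  fun _ hk => absurd hk (Nat.not_lt_zero _)

theorem succ_iff : VanishesToOrder (m + 1) F v ↔
    MvPolynomial.eval v F = 0 ∧ ∀ i, VanishesToOrder m (MvPolynomial.pderiv i F) v := by
  constructor
  · intro h
    refine ⟨by simpa using h 0 (Nat.succ_pos m) Fin.elim0, fun i k hk d => ?_⟩
    simpa [List.ofFn_succ] using h (k + 1) (Nat.succ_lt_succ hk) (Fin.cons i d)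
  · rintro ⟨h₀, h⟩ (_ | k) hk d
    · simpa using h₀
    · simpa [List.ofFn_succ] using h (d 0) k (Nat.lt_of_succ_lt_succ hk) (fun j => d j.succ)

theorem mono (h : VanishesToOrder m F v) (hnm : n ≤ m) : VanishesToOrder n F v :=
  fun k hk d => h k (hk.trans_le hnm) d

theorem add (hF : VanishesToOrder m F v) (hG : VanishesToOrder m G v) :
    VanishesToOrder m (F + G) v := by
  induction m generalizing F G with
  | zero => exact zero _ _
  | succ m ih =>
    rw [succ_iff] at *
    refine ⟨by simp [hF.1, hG.1], fun i => ?_⟩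
    rw [map_add]
    exact ih (hF.2 i) (hG.2 i)

theorem mul (hF : VanishesToOrder m F v) (hG : VanishesToOrder n G v) :
    VanishesToOrder (m + n) (F * G) v := by
  induction hN : m + n generalizing F G m n with
  | zero => exact zero _ _
  | succ N ih =>
    refine succ_iff.2 ⟨?_, fun i => ?_⟩
    · rcases m with _ | m
      · obtain rfl : n = N + 1 := by omega
        simp [(succ_iff.1 hG).1]
      · simp [(succ_iff.1 hF).1]
    · rw [MvPolynomial.pderiv_mul]
      refine add ?_ ?_
      · rcases m with _ | m
        · exact ih (zero _ v) (hG.mono (show N ≤ n by omega)) (by omega)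
        · exact ih ((succ_iff.1 hF).2 i) hG (by omega)
      · rcases n with _ | n
        · exact ih (hF.mono (show N ≤ m by omega)) (zero _ v) (by omega)
        · exact ih hF ((succ_iff.1 hG).2 i) (by omega)

theorem pow (hF : VanishesToOrder m F v) (k : ℕ) : VanishesToOrder (k * m) (F ^ k) v := by
  induction k with
  | zero => simpa using zero _ v
  | succ k ih => simpa [pow_succ, Nat.succ_mul] using ih.mul hF

theorem one (h : MvPolynomial.eval v F = 0) : VanishesToOrder 1 F v :=
  succ_iff.2 ⟨h, fun _ => zero _ _⟩

end VanishesToOrder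

/-- The restriction of `F` to the generic line through `v`: the polynomial `F (v + T x)` in the
parameter `T`, whose coefficients are polynomials in the direction `x`. -/
noncomputable def genericLine (v : Fin 3 → ℂ) :
    MvPolynomial (Fin 3) ℂ →ₐ[ℂ] Polynomial (MvPolynomial (Fin 3) ℂ) :=
  MvPolynomial.aeval fun i =>
    Polynomial.C (MvPolynomial.C (v i)) + Polynomial.C (MvPolynomial.X i) * Polynomial.X

/-- The restriction of `F` to the line through `v` with direction `w`, as a polynomial in the
parameter. -/
noncomputable def alongLine (v w : Fin 3 → ℂ) :
    MvPolynomial (Fin 3) ℂ →ₐ[ℂ] Polynomial ℂ :=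
  MvPolynomial.aeval fun i => Polynomial.C (v i) + Polynomial.C (w i) * Polynomial.X

theorem map_genericLine (v w : Fin 3 → ℂ) (F : MvPolynomial (Fin 3) ℂ) :
    (genericLine v F).map (MvPolynomial.eval w) = alongLine v w F := by
  have : (Polynomial.mapAlgHom (MvPolynomial.aeval (R := ℂ) w)).comp (genericLine v) =
      alongLine v w := by
    ext i
    simp [genericLine, alongLine]
  simpa [Polynomial.mapAlgHom, MvPolynomial.aeval_def, MvPolynomial.eval] using
    DFunLike.congr_fun this F

theorem derivative_genericLine (v : Fin 3 → ℂ) (F : MvPolynomial (Fin 3) ℂ) :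
    Polynomial.derivative (genericLine v F) =
      ∑ i, Polynomial.C (MvPolynomial.X i) * genericLine v (MvPolynomial.pderiv i F) := by
  induction F using MvPolynomial.induction_on with
  | C a =>
    have : genericLine v (MvPolynomial.C a) = Polynomial.C (MvPolynomial.C a) := by
      simp [genericLine]
    simp [this]
  | add p q hp hq => simp [hp, hq, mul_add, Finset.sum_add_distrib]
  | mul_X p j hp =>
    have hX : genericLine v (MvPolynomial.X j) =
        Polynomial.C (MvPolynomial.C (v j)) + Polynomial.C (MvPolynomial.X j) * Polynomial.X := by
      simp [genericLine]
    have hsum : ∑ i, Polynomial.C (MvPolynomial.X i) *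
        genericLine v (MvPolynomial.pderiv i (MvPolynomial.X j)) =
        Polynomial.C (MvPolynomial.X (R := ℂ) j) := by
      rw [Finset.sum_eq_single j]
      · simp
      · intro i _ hij
        simp [MvPolynomial.pderiv_X_of_ne hij.symm]
      · simp
    have hder : Polynomial.derivative (genericLine v (MvPolynomial.X j)) =
        Polynomial.C (MvPolynomial.X j) := by simp [hX]
    rw [map_mul, Polynomial.derivative_mul, hp, hder, ← hsum, Finset.sum_mul, Finset.mul_sum,
      ← Finset.sum_add_distrib]
    refine Finset.sum_congr rfl fun i _ => ?_
    rw [MvPolynomial.pderiv_mul, map_add, map_mul, map_mul]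
    ring

theorem coeff_zero_genericLine (v : Fin 3 → ℂ) (F : MvPolynomial (Fin 3) ℂ) :
    (genericLine v F).coeff 0 = MvPolynomial.C (MvPolynomial.eval v F) := by
  induction F using MvPolynomial.induction_on with
  | C a =>
    have : genericLine v (MvPolynomial.C a) = Polynomial.C (MvPolynomial.C a) := by
      simp [genericLine]
    simp [this]
  | add p q hp hq => simp [hp, hq]
  | mul_X p j hp =>
    have hX : (genericLine v (MvPolynomial.X j)).coeff 0 = MvPolynomial.C (v j) := by
      simp [genericLine]
    rw [map_mul, Polynomial.mul_coeff_zero, hp, hX, map_mul, MvPolynomial.eval_X, map_mul]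

theorem VanishesToOrder.X_pow_dvd {m : ℕ} {F : MvPolynomial (Fin 3) ℂ} {v : Fin 3 → ℂ}
    (h : VanishesToOrder m F v) : Polynomial.X ^ m ∣ genericLine v F := by
  induction m generalizing F with
  | zero => simp
  | succ m ih =>
    rw [VanishesToOrder.succ_iff] at h
    have hder : Polynomial.X ^ m ∣ Polynomial.derivative (genericLine v F) := by
      rw [derivative_genericLine]
      exact Finset.dvd_sum fun i _ => (ih (h.2 i)).mul_left _
    rw [Polynomial.X_pow_dvd_iff] at hder ⊢
    rintro (_ | d) hd
    · simp [coeff_zero_genericLine, h.1]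
    · have := hder d (by omega)
      rw [Polynomial.coeff_derivative] at this
      refine (mul_eq_zero.1 this).resolve_right ?_
      exact_mod_cast Nat.succ_ne_zero d

theorem genericLine_linear {L : MvPolynomial (Fin 3) ℂ} (hL : L.IsHomogeneous 1)
    (v : Fin 3 → ℂ) : genericLine v L =
      Polynomial.C (MvPolynomial.C (MvPolynomial.eval v L)) + Polynomial.C L * Polynomial.X := by
  rw [← MvPolynomial.mem_homogeneousSubmodule,
    MvPolynomial.homogeneousSubmodule_one_eq_span_X] at hL
  induction hL using Submodule.span_induction with
  | mem x hx =>
    obtain ⟨i, rfl⟩ := hx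
    simp [genericLine]
  | zero => simp
  | add x y _ _ hx hy => simp only [map_add, hx, hy]; ring
  | smul a x _ hx =>
    have hC : genericLine v (MvPolynomial.C a) = Polynomial.C (MvPolynomial.C a) := by
      simp [genericLine]
    simp only [hx, hC, MvPolynomial.smul_eq_C_mul, map_mul, MvPolynomial.eval_C]
    ring

theorem eval_add_smul {L : MvPolynomial (Fin 3) ℂ} (hL : L.IsHomogeneous 1)
    (v w : Fin 3 → ℂ) (a b : ℂ) : MvPolynomial.eval (a • v + b • w) L =
      a * MvPolynomial.eval v L + b * MvPolynomial.eval w L := by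
  rw [← MvPolynomial.mem_homogeneousSubmodule,
    MvPolynomial.homogeneousSubmodule_one_eq_span_X] at hL
  induction hL using Submodule.span_induction with
  | mem x hx =>
    obtain ⟨i, rfl⟩ := hx
    simp
  | zero => simp
  | add x y _ _ hx hy => simp only [map_add, hx, hy]; ring
  | smul c x _ hx => simp only [MvPolynomial.smul_eval, hx]; ring

theorem X_pow_dvd_of_mul_of_eval_ne_zero {L G : MvPolynomial (Fin 3) ℂ} {v : Fin 3 → ℂ} {m : ℕ}
    (hv : MvPolynomial.eval v L ≠ 0) (h : Polynomial.X ^ m ∣ genericLine v (L * G)) :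
    Polynomial.X ^ m ∣ genericLine v G := by
  rw [map_mul] at h
  refine Polynomial.prime_X.pow_dvd_of_dvd_mul_left m ?_ h
  rwa [Polynomial.X_dvd_iff, coeff_zero_genericLine, MvPolynomial.C_eq_zero]

theorem X_pow_sub_one_dvd_of_mul {L G : MvPolynomial (Fin 3) ℂ} (hL : IsLine L) {v : Fin 3 → ℂ}
    {m : ℕ} (h : Polynomial.X ^ m ∣ genericLine v (L * G)) :
    Polynomial.X ^ (m - 1) ∣ genericLine v G := by
  by_cases hv : MvPolynomial.eval v L = 0
  · rcases m with _ | m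
    · simp
    rw [map_mul, genericLine_linear hL.2, hv, map_zero, map_zero, zero_add, pow_succ', mul_comm
      (Polynomial.C L), mul_assoc] at h
    refine Polynomial.prime_X.pow_dvd_of_dvd_mul_left m ?_
      ((mul_dvd_mul_iff_left Polynomial.X_ne_zero).1 h)
    rw [Polynomial.X_dvd_iff, Polynomial.coeff_C_zero]
    exact hL.1
  · exact (pow_dvd_pow _ (Nat.sub_le m 1)).trans (X_pow_dvd_of_mul_of_eval_ne_zero hv h)

theorem exists_homogeneous_factor {L F : MvPolynomial (Fin 3) ℂ} {d : ℕ}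
    (hL : L.IsHomogeneous 1) (hF : F.IsHomogeneous d) (hF₀ : F ≠ 0) (h : L ∣ F) :
    ∃ n G, d = n + 1 ∧ G.IsHomogeneous n ∧ F = L * G := by
  obtain ⟨G, rfl⟩ := h
  have hL₀ := left_ne_zero_of_mul hF₀
  have hd : d = 1 + G.totalDegree := by
    rw [← hF.totalDegree hF₀, MvPolynomial.totalDegree_mul_of_isDomain hL₀
      (right_ne_zero_of_mul hF₀), hL.totalDegree hL₀]
  let _ := MvPolynomial.gradedAlgebra (σ := Fin 3) (R := ℂ)
  have hmul := DirectSum.coe_decompose_mul_add_of_left_mem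
    (MvPolynomial.homogeneousSubmodule (Fin 3) ℂ) (i := 1) (j := G.totalDegree) (a := L) (b := G) hL
  rw [← hd, DirectSum.decompose_of_mem_same _ hF] at hmul
  exact ⟨G.totalDegree, _, by omega,
    (MvPolynomial.mem_homogeneousSubmodule _ _).1 (SetLike.coe_mem _), hmul⟩

theorem line_dvd_of_forall_eval {L F : MvPolynomial (Fin 3) ℂ} (hL : IsLine L)
    (h : ∀ v, MvPolynomial.eval v L = 0 → MvPolynomial.eval v F = 0) : L ∣ F := by
  obtain ⟨e, he⟩ : ∃ e, MvPolynomial.eval e L ≠ 0 := by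
    by_contra! hcon
    exact hL.1 (MvPolynomial.funext (by simpa using hcon))
  let c : Fin 3 → ℂ := (MvPolynomial.eval e L)⁻¹ • e
  let F' := MvPolynomial.aeval (R := ℂ) (fun i => MvPolynomial.X i - MvPolynomial.C (c i) * L) F
  have hF' : F' = 0 := by
    refine MvPolynomial.funext fun x => ?_
    have : MvPolynomial.eval x F' =
        MvPolynomial.eval
          ((1 : ℂ) • x + (-(MvPolynomial.eval x L * (MvPolynomial.eval e L)⁻¹)) • e) F := by
      simp only [F', ← MvPolynomial.aeval_eq_eval, ← AlgHom.comp_apply]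
      congr 1
      ext i
      simp [c, MvPolynomial.aeval_eq_eval]
      ring
    rw [this, h _ ?_, map_zero]
    rw [eval_add_smul hL.2]
    field_simp
    ring
  have hq : Ideal.Quotient.mkₐ ℂ (Ideal.span {L}) F' =
      Ideal.Quotient.mkₐ ℂ (Ideal.span {L}) F := by
    have : (Ideal.Quotient.mkₐ ℂ (Ideal.span {L})).comp
        (MvPolynomial.aeval (R := ℂ) (fun i => MvPolynomial.X i - MvPolynomial.C (c i) * L)) =
        Ideal.Quotient.mkₐ ℂ (Ideal.span {L}) := by
      ext i
      have : Ideal.Quotient.mk (Ideal.span {L}) L = 0 :=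
        Ideal.Quotient.eq_zero_iff_mem.2 (Ideal.mem_span_singleton_self L)
      simp [this]
    exact DFunLike.congr_fun this F
  rw [hF', map_zero] at hq
  exact Ideal.mem_span_singleton.1 (Ideal.Quotient.eq_zero_iff_mem.1 hq.symm)

theorem exists_eq_smul_add_smul {L : MvPolynomial (Fin 3) ℂ} (hL : IsLine L) {p q u : Fin 3 → ℂ}
    (hpq : LinearIndependent ℂ ![p, q]) (hp : MvPolynomial.eval p L = 0)
    (hq : MvPolynomial.eval q L = 0) (hu : MvPolynomial.eval u L = 0) :
    ∃ a b : ℂ, u = a • p + b • q := by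
  by_contra! hcon
  have hind : LinearIndependent ℂ ![u, p, q] := by
    refine linearIndependent_finCons.2 ⟨hpq, fun hmem => ?_⟩
    rw [Matrix.range_cons_cons_empty] at hmem
    obtain ⟨a, b, hab⟩ := Submodule.mem_span_pair.1 hmem
    exact hcon a b hab.symm
  refine hL.1 (MvPolynomial.funext fun x => ?_)
  have hspan := hind.span_eq_top_of_card_eq_finrank' (by simp)
  have hx : x ∈ Submodule.span ℂ (Set.range ![u, p, q]) := hspan ▸ Submodule.mem_top
  rw [Matrix.range_cons, Matrix.range_cons_cons_empty, Set.singleton_union] at hx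
  obtain ⟨a, b, c, rfl⟩ := Submodule.mem_span_triple.1 hx
  have : a • u + b • p + c • q = (1 : ℂ) • (a • u + b • p) + c • q := by simp
  rw [this, eval_add_smul hL.2, eval_add_smul hL.2, hu, hp, hq]
  simp

theorem eval_alongLine (v w : Fin 3 → ℂ) (F : MvPolynomial (Fin 3) ℂ) (t : ℂ) :
    (alongLine v w F).eval t = MvPolynomial.eval (v + t • w) F := by
  have : (Polynomial.aeval t).comp (alongLine v w) = MvPolynomial.aeval (R := ℂ) (v + t • w) := by
    ext i
    simp [alongLine]
    ring
  simpa [MvPolynomial.aeval_eq_eval, Polynomial.coe_aeval_eq_eval] using DFunLike.congr_fun this F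

theorem alongLine_comp (v w : Fin 3 → ℂ) (F : MvPolynomial (Fin 3) ℂ) (t : ℂ) :
    (alongLine v w F).comp (Polynomial.X + Polynomial.C t) = alongLine (v + t • w) w F := by
  refine Polynomial.funext fun s => ?_
  rw [Polynomial.eval_comp, eval_alongLine, eval_alongLine]
  congr 2
  ext i
  simp
  ring

theorem eval_smul_of_isHomogeneous {F : MvPolynomial (Fin 3) ℂ} {d : ℕ} (hF : F.IsHomogeneous d)
    (c : ℂ) (v : Fin 3 → ℂ) :
    MvPolynomial.eval (c • v) F = c ^ d * MvPolynomial.eval v F := by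
  rw [MvPolynomial.eval_eq, MvPolynomial.eval_eq, Finset.mul_sum]
  refine Finset.sum_congr rfl fun s hs => ?_
  rw [hF.degree_eq_sum_deg_support hs]
  simp only [Pi.smul_apply, smul_eq_mul, mul_pow, Finset.prod_mul_distrib,
    Finset.prod_pow_eq_pow_sum]
  ring

theorem X_pow_dvd_alongLine_smul {F : MvPolynomial (Fin 3) ℂ} {d m : ℕ} {v : Fin 3 → ℂ}
    (hF : F.IsHomogeneous d) (h : Polynomial.X ^ m ∣ genericLine v F) {c : ℂ} (hc : c ≠ 0)
    (w : Fin 3 → ℂ) : Polynomial.X ^ m ∣ alongLine (c • v) w F := by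
  have hscale : alongLine (c • v) w F = Polynomial.C (c ^ d) * alongLine v (c⁻¹ • w) F := by
    refine Polynomial.funext fun t => ?_
    rw [Polynomial.eval_mul, Polynomial.eval_C, eval_alongLine, eval_alongLine,
      ← eval_smul_of_isHomogeneous hF]
    congr 2
    rw [smul_add, smul_comm t, smul_inv_smul₀ hc]
  rw [hscale, ← map_genericLine]
  refine Dvd.dvd.mul_left ?_ _
  simpa using Polynomial.map_dvd (MvPolynomial.eval (c⁻¹ • w)) h

theorem natDegree_alongLine_le {F : MvPolynomial (Fin 3) ℂ} {d : ℕ} (hF : F.IsHomogeneous d)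
    (v w : Fin 3 → ℂ) : (alongLine v w F).natDegree ≤ d := by
  have := MvPolynomial.aeval_natDegree_le F hF.totalDegree_le
    (fun i => Polynomial.C (v i) + Polynomial.C (w i) * Polynomial.X) (n := 1)
    (fun i => by compute_degree)
  simpa [alongLine] using this

/-- Bézout's inequality for a plane curve and a line, counted at three points of the line. -/
theorem sum_orders_le_degree {L F : MvPolynomial (Fin 3) ℂ} {d m₁ m₂ m₃ : ℕ}
    (hL : IsLine L) (hF : F.IsHomogeneous d) (hLF : ¬ L ∣ F) {p q : Fin 3 → ℂ}
    (hpq : LinearIndependent ℂ ![p, q]) (hp : MvPolynomial.eval p L = 0)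
    (hq : MvPolynomial.eval q L = 0) {a b : ℂ} (ha : a ≠ 0) (hb : b ≠ 0)
    (h₁ : Polynomial.X ^ m₁ ∣ genericLine p F) (h₂ : Polynomial.X ^ m₂ ∣ genericLine q F)
    (h₃ : Polynomial.X ^ m₃ ∣ genericLine (a • p + b • q) F) :
    m₁ + m₂ + m₃ ≤ d := by
  let w := b • q - a • p
  let g := alongLine (a • p) w F
  have hroot : ∀ (t c : ℂ) (m : ℕ) (v : Fin 3 → ℂ), c ≠ 0 → c • v = a • p + t • w →
      Polynomial.X ^ m ∣ genericLine v F → (Polynomial.X - Polynomial.C t) ^ m ∣ g := by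
    intro t c m v hc hv hm
    have h := X_pow_dvd_alongLine_smul hF hm hc w
    rw [hv, ← alongLine_comp, Polynomial.dvd_comp_X_add_C_iff] at h
    simpa using h
  have d₁ := hroot 0 a m₁ p ha (by simp) h₁
  have d₂ := hroot 1 b m₂ q hb (by simp [w]) h₂
  have d₃ := hroot 2⁻¹ 2⁻¹ m₃ _ (by simp) (by ext i; simp [w]; ring) h₃
  have hg : g ≠ 0 := by
    intro hg
    refine hLF (line_dvd_of_forall_eval hL fun u hu => ?_)
    obtain ⟨s, t, rfl⟩ := exists_eq_smul_add_smul hL hpq hp hq hu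
    have hgen : ∀ s t : ℂ, s + t ≠ 0 → MvPolynomial.eval (s • (a • p) + t • (b • q)) F = 0 := by
      intro s t hst
      have h₀ : (s + t) • (a • p + (t / (s + t)) • w) = s • (a • p) + t • (b • q) := by
        ext i
        simp [w]
        field_simp
        ring
      rw [← h₀, eval_smul_of_isHomogeneous hF, ← eval_alongLine]
      change _ * Polynomial.eval _ g = 0
      rw [hg, Polynomial.eval_zero, mul_zero]
    have hall : ∀ s t : ℂ, MvPolynomial.eval (s • (a • p) + t • (b • q)) F = 0 := by
      intro s t
      have hzero : (Polynomial.X + Polynomial.C (s + t)) *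
          alongLine (s • (a • p) + t • (b • q)) (a • p) F = 0 := by
        refine Polynomial.funext fun x => ?_
        rw [Polynomial.eval_mul, eval_alongLine]
        by_cases hx : x + (s + t) = 0
        · simp [hx]
        · have := hgen (s + x) t (by rwa [show s + x + t = x + (s + t) by ring])
          rw [add_smul, add_right_comm] at this
          simp [this]
      have hline := (mul_eq_zero.1 hzero).resolve_left (Polynomial.X_add_C_ne_zero _)
      simpa [eval_alongLine] using congrArg (Polynomial.eval 0) hline
    have := hall (s / a) (t / b)
    rwa [smul_smul, smul_smul, div_mul_cancel₀ _ ha, div_mul_cancel₀ _ hb] at this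
  have hcop : ∀ {s t : ℂ} {m n : ℕ}, s ≠ t → IsCoprime ((Polynomial.X - Polynomial.C s) ^ m)
      ((Polynomial.X - Polynomial.C t) ^ n) := fun hst =>
    (Polynomial.isCoprime_X_sub_C_of_isUnit_sub (sub_ne_zero.2 hst).isUnit).pow
  have hdvd := IsCoprime.mul_dvd (IsCoprime.mul_left (hcop (by norm_num)) (hcop (by norm_num)))
    (IsCoprime.mul_dvd (hcop zero_ne_one) d₁ d₂) d₃
  refine le_trans (le_of_eq ?_)
    ((Polynomial.natDegree_le_of_dvd hdvd hg).trans (natDegree_alongLine_le hF _ _))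
  have hne : ∀ (t : ℂ) (m : ℕ), (Polynomial.X - Polynomial.C t) ^ m ≠ 0 := fun t m =>
    pow_ne_zero _ (Polynomial.X_sub_C_ne_zero t)
  rw [Polynomial.natDegree_mul (mul_ne_zero (hne _ _) (hne _ _)) (hne _ _),
    Polynomial.natDegree_mul (hne _ _) (hne _ _)]
  simp only [Polynomial.natDegree_pow, Polynomial.natDegree_X_sub_C, mul_one]

/-- The form `F` has order of vanishing at least `m` at the point `P` of the projective plane,
read off from its restriction to the generic line through `P`. -/
def HasOrderAt (m : ℕ) (F : MvPolynomial (Fin 3) ℂ) (P : ℙ ℂ (Fin 3 → ℂ)) : Prop :=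
  Polynomial.X ^ m ∣ genericLine P.rep F

theorem hasOrderAt_of_mem_symbolicPower {Z : Set (ℙ ℂ (Fin 3 → ℂ))} {m : ℕ}
    {F : MvPolynomial (Fin 3) ℂ} (hF : F ∈ symbolicPower Z m) {P : ℙ ℂ (Fin 3 → ℂ)} (hP : P ∈ Z) :
    HasOrderAt m F P :=
  (hF P hP P.rep P.rep_nonzero P.mk_rep).X_pow_dvd

theorem HasOrderAt.of_mul_of_not_memLine {m : ℕ} {L G : MvPolynomial (Fin 3) ℂ}
    {P : ℙ ℂ (Fin 3 → ℂ)} (h : HasOrderAt m (L * G) P) (hP : MvPolynomial.eval P.rep L ≠ 0) :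
    HasOrderAt m G P :=
  X_pow_dvd_of_mul_of_eval_ne_zero hP h

theorem HasOrderAt.of_mul {m : ℕ} {L G : MvPolynomial (Fin 3) ℂ} {P : ℙ ℂ (Fin 3 → ℂ)}
    (h : HasOrderAt m (L * G) P) (hL : IsLine L) : HasOrderAt (m - 1) G P :=
  X_pow_sub_one_dvd_of_mul hL h

theorem MemLine.eval_rep {L : MvPolynomial (Fin 3) ℂ} {P : ℙ ℂ (Fin 3 → ℂ)} (h : MemLine L P) :
    MvPolynomial.eval P.rep L = 0 :=
  h P.rep P.rep_nonzero P.mk_rep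

theorem memLine_iff {L : MvPolynomial (Fin 3) ℂ} (hL : IsLine L) {P : ℙ ℂ (Fin 3 → ℂ)} :
    MemLine L P ↔ MvPolynomial.eval P.rep L = 0 := by
  refine ⟨MemLine.eval_rep, fun h v hv hvP => ?_⟩
  subst hvP
  obtain ⟨a, ha⟩ := Projectivization.exists_smul_eq_mk_rep ℂ v hv
  rw [← ha, Units.smul_def, eval_smul_of_isHomogeneous hL.2, pow_one] at h
  exact (mul_eq_zero.1 h).resolve_left a.ne_zero

theorem exists_line_through {P Q : ℙ ℂ (Fin 3 → ℂ)} (hPQ : P ≠ Q) :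
    ∃ N, IsLine N ∧ MemLine N P ∧ MemLine N Q := by
  have hind := Projectivization.linearIndependent_pair_iff_ne.2 hPQ
  let c := crossProduct P.rep Q.rep
  have hc : c ≠ 0 := crossProduct_ne_zero_iff_linearIndependent.2 hind
  let N : MvPolynomial (Fin 3) ℂ := ∑ i, MvPolynomial.C (c i) * MvPolynomial.X i
  have heval : ∀ v, MvPolynomial.eval v N = v ⬝ᵥ c := by
    intro v
    simp [N, dotProduct, mul_comm]
  have hN : IsLine N := by
    refine ⟨fun h₀ => hc (funext fun i => ?_),
      MvPolynomial.IsHomogeneous.sum _ _ _ fun i _ => MvPolynomial.isHomogeneous_C_mul_X _ _⟩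
    have := heval (Pi.single i 1)
    rw [h₀] at this
    simpa using this.symm
  refine ⟨N, hN, (memLine_iff hN).2 ?_, (memLine_iff hN).2 ?_⟩
  · rw [heval, dot_self_cross]
  · rw [heval, dot_cross_self]

theorem MemLine.of_two_points {A B : MvPolynomial (Fin 3) ℂ} (hA : IsLine A) (hB : IsLine B)
    {P Q R : ℙ ℂ (Fin 3 → ℂ)} (hPQ : P ≠ Q) (hPA : MemLine A P) (hQA : MemLine A Q)
    (hRA : MemLine A R) (hPB : MemLine B P) (hQB : MemLine B Q) : MemLine B R := by
  obtain ⟨a, b, hab⟩ := exists_eq_smul_add_smul hA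
    (Projectivization.linearIndependent_pair_iff_ne.2 hPQ) hPA.eval_rep hQA.eval_rep hRA.eval_rep
  rw [memLine_iff hB, hab, eval_add_smul hB.2, hPB.eval_rep, hQB.eval_rep]
  simp

theorem order_add_order_le_degree {L F : MvPolynomial (Fin 3) ℂ} {d m₁ m₂ : ℕ}
    (hL : IsLine L) (hF : F.IsHomogeneous d) (hLF : ¬ L ∣ F) {P Q : ℙ ℂ (Fin 3 → ℂ)}
    (hPQ : P ≠ Q) (hP : MemLine L P) (hQ : MemLine L Q)
    (h₁ : HasOrderAt m₁ F P) (h₂ : HasOrderAt m₂ F Q) : m₁ + m₂ ≤ d :=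
  sum_orders_le_degree (m₃ := 0) hL hF hLF
    (Projectivization.linearIndependent_pair_iff_ne.2 hPQ) hP.eval_rep hQ.eval_rep
    one_ne_zero one_ne_zero h₁ h₂ (by simp)

theorem order_add_order_add_order_le_degree {L F : MvPolynomial (Fin 3) ℂ} {d m₁ m₂ m₃ : ℕ}
    (hL : IsLine L) (hF : F.IsHomogeneous d) (hLF : ¬ L ∣ F) {P Q R : ℙ ℂ (Fin 3 → ℂ)}
    (hPQ : P ≠ Q) (hRP : R ≠ P) (hRQ : R ≠ Q)
    (hP : MemLine L P) (hQ : MemLine L Q) (hR : MemLine L R)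
    (h₁ : HasOrderAt m₁ F P) (h₂ : HasOrderAt m₂ F Q) (h₃ : HasOrderAt m₃ F R) :
    m₁ + m₂ + m₃ ≤ d := by
  have hind := Projectivization.linearIndependent_pair_iff_ne.2 hPQ
  obtain ⟨a, b, hab⟩ := exists_eq_smul_add_smul hL hind hP.eval_rep hQ.eval_rep hR.eval_rep
  have hne : ∀ {S : ℙ ℂ (Fin 3 → ℂ)} {c : ℂ}, R ≠ S → R.rep ≠ c • S.rep := by
    intro S c hRS h
    refine hRS ?_
    rw [← R.mk_rep, ← S.mk_rep, Projectivization.mk_eq_mk_iff']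
    exact ⟨c, h.symm⟩
  have ha : a ≠ 0 := by
    rintro rfl
    exact hne hRQ (by simpa using hab)
  have hb : b ≠ 0 := by
    rintro rfl
    exact hne hRP (by simpa using hab)
  refine sum_orders_le_degree hL hF hLF hind hP.eval_rep hQ.eval_rep ha hb h₁ h₂ ?_
  rw [← hab]
  exact h₃

/-- The class `4L - (V₁ + V₂ + V₃) - 2 (D₁ + D₂ + D₃)` is nef: it is the sum of the two sides
`M₁`, `M₃` and the two lines `N₁ = D₂D₃`, `N₃ = D₁D₂`, and meets each of them in degree zero. -/
theorem weighted_orders_le_degree {M₁ M₃ N₁ N₃ : MvPolynomial (Fin 3) ℂ}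
    (hM₁ : IsLine M₁) (hM₃ : IsLine M₃) (hN₁ : IsLine N₁) (hN₃ : IsLine N₃)
    {V₁ V₂ V₃ D₁ D₂ D₃ : ℙ ℂ (Fin 3 → ℂ)}
    (hV₁₂ : V₁ ≠ V₂) (hV₂₃ : V₂ ≠ V₃) (hD₁V₂ : D₁ ≠ V₂) (hD₁V₃ : D₁ ≠ V₃) (hD₃V₁ : D₃ ≠ V₁)
    (hD₃V₂ : D₃ ≠ V₂) (hD₁₂ : D₁ ≠ D₂) (hD₂₃ : D₂ ≠ D₃)
    (hM₁on : MemLine M₁ V₂ ∧ MemLine M₁ V₃ ∧ MemLine M₁ D₁)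
    (hM₁off : ¬ MemLine M₁ V₁ ∧ ¬ MemLine M₁ D₂ ∧ ¬ MemLine M₁ D₃)
    (hM₃on : MemLine M₃ V₁ ∧ MemLine M₃ V₂ ∧ MemLine M₃ D₃)
    (hM₃off : ¬ MemLine M₃ V₃ ∧ ¬ MemLine M₃ D₁ ∧ ¬ MemLine M₃ D₂)
    (hN₁on : MemLine N₁ D₂ ∧ MemLine N₁ D₃)
    (hN₁off : ¬ MemLine N₁ V₁ ∧ ¬ MemLine N₁ V₂ ∧ ¬ MemLine N₁ V₃ ∧ ¬ MemLine N₁ D₁)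
    (hN₃on : MemLine N₃ D₁ ∧ MemLine N₃ D₂)
    (hN₃off : ¬ MemLine N₃ V₁ ∧ ¬ MemLine N₃ V₂ ∧ ¬ MemLine N₃ V₃ ∧ ¬ MemLine N₃ D₃)
    {d : ℕ} {F : MvPolynomial (Fin 3) ℂ} (hF : F.IsHomogeneous d) (hF₀ : F ≠ 0)
    {a₁ a₂ a₃ b₁ b₂ b₃ : ℕ} (ha₁ : HasOrderAt a₁ F V₁) (ha₂ : HasOrderAt a₂ F V₂)
    (ha₃ : HasOrderAt a₃ F V₃) (hb₁ : HasOrderAt b₁ F D₁) (hb₂ : HasOrderAt b₂ F D₂)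
    (hb₃ : HasOrderAt b₃ F D₃) :
    a₁ + a₂ + a₃ + 2 * (b₁ + b₂ + b₃) ≤ 4 * d := by
  induction d generalizing F a₁ a₂ a₃ b₁ b₂ b₃ with
  | zero =>
    have hndvd : ∀ {L : MvPolynomial (Fin 3) ℂ}, IsLine L → ¬ L ∣ F := fun hL h => by
      obtain ⟨n, -, hn, -⟩ := exists_homogeneous_factor hL.2 hF hF₀ h
      omega
    have e₁ := order_add_order_add_order_le_degree hM₁ hF (hndvd hM₁) hV₂₃ hD₁V₂ hD₁V₃
      hM₁on.1 hM₁on.2.1 hM₁on.2.2 ha₂ ha₃ hb₁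
    have e₃ := order_add_order_add_order_le_degree hM₃ hF (hndvd hM₃) hV₁₂ hD₃V₁ hD₃V₂
      hM₃on.1 hM₃on.2.1 hM₃on.2.2 ha₁ ha₂ hb₃
    have f₃ := order_add_order_le_degree hN₃ hF (hndvd hN₃) hD₁₂ hN₃on.1 hN₃on.2 hb₁ hb₂
    omega
  | succ d ih =>
    have hfac : ∀ {L : MvPolynomial (Fin 3) ℂ}, IsLine L → L ∣ F →
        ∃ G, G.IsHomogeneous d ∧ G ≠ 0 ∧ F = L * G := fun hL h => by
      obtain ⟨n, G, hn, hG, rfl⟩ := exists_homogeneous_factor hL.2 hF hF₀ h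
      obtain rfl : d = n := by omega
      exact ⟨G, hG, right_ne_zero_of_mul hF₀, rfl⟩
    by_cases dM₁ : M₁ ∣ F
    · obtain ⟨G, hG, hG₀, rfl⟩ := hfac hM₁ dM₁
      rw [memLine_iff hM₁, memLine_iff hM₁, memLine_iff hM₁] at hM₁off
      have := ih hG hG₀ (ha₁.of_mul_of_not_memLine hM₁off.1) (ha₂.of_mul hM₁) (ha₃.of_mul hM₁)
        (hb₁.of_mul hM₁) (hb₂.of_mul_of_not_memLine hM₁off.2.1)
        (hb₃.of_mul_of_not_memLine hM₁off.2.2)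
      omega
    by_cases dM₃ : M₃ ∣ F
    · obtain ⟨G, hG, hG₀, rfl⟩ := hfac hM₃ dM₃
      rw [memLine_iff hM₃, memLine_iff hM₃, memLine_iff hM₃] at hM₃off
      have := ih hG hG₀ (ha₁.of_mul hM₃) (ha₂.of_mul hM₃) (ha₃.of_mul_of_not_memLine hM₃off.1)
        (hb₁.of_mul_of_not_memLine hM₃off.2.1) (hb₂.of_mul_of_not_memLine hM₃off.2.2)
        (hb₃.of_mul hM₃)
      omega
    by_cases dN₁ : N₁ ∣ F
    · obtain ⟨G, hG, hG₀, rfl⟩ := hfac hN₁ dN₁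
      rw [memLine_iff hN₁, memLine_iff hN₁, memLine_iff hN₁, memLine_iff hN₁] at hN₁off
      have := ih hG hG₀ (ha₁.of_mul_of_not_memLine hN₁off.1)
        (ha₂.of_mul_of_not_memLine hN₁off.2.1) (ha₃.of_mul_of_not_memLine hN₁off.2.2.1)
        (hb₁.of_mul_of_not_memLine hN₁off.2.2.2) (hb₂.of_mul hN₁) (hb₃.of_mul hN₁)
      omega
    by_cases dN₃ : N₃ ∣ F
    · obtain ⟨G, hG, hG₀, rfl⟩ := hfac hN₃ dN₃
      rw [memLine_iff hN₃, memLine_iff hN₃, memLine_iff hN₃, memLine_iff hN₃] at hN₃off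
      have := ih hG hG₀ (ha₁.of_mul_of_not_memLine hN₃off.1)
        (ha₂.of_mul_of_not_memLine hN₃off.2.1) (ha₃.of_mul_of_not_memLine hN₃off.2.2.1)
        (hb₁.of_mul hN₃) (hb₂.of_mul hN₃) (hb₃.of_mul_of_not_memLine hN₃off.2.2.2)
      omega
    have e₁ := order_add_order_add_order_le_degree hM₁ hF dM₁ hV₂₃ hD₁V₂ hD₁V₃
      hM₁on.1 hM₁on.2.1 hM₁on.2.2 ha₂ ha₃ hb₁
    have e₃ := order_add_order_add_order_le_degree hM₃ hF dM₃ hV₁₂ hD₃V₁ hD₃V₂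
      hM₃on.1 hM₃on.2.1 hM₃on.2.2 ha₁ ha₂ hb₃
    have f₁ := order_add_order_le_degree hN₁ hF dN₁ hD₂₃ hN₁on.1 hN₁on.2 hb₂ hb₃
    have f₃ := order_add_order_le_degree hN₃ hF dN₃ hD₁₂ hN₃on.1 hN₃on.2 hb₁ hb₂
    omega

theorem mul_mem_symbolicPower {Z : Set (ℙ ℂ (Fin 3 → ℂ))} {m n : ℕ}
    {F G : MvPolynomial (Fin 3) ℂ} (hF : F ∈ symbolicPower Z m) (hG : G ∈ symbolicPower Z n) :
    F * G ∈ symbolicPower Z (m + n) :=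
  fun P hP v hv hvP => (hF P hP v hv hvP).mul (hG P hP v hv hvP)

theorem pow_mem_symbolicPower {Z : Set (ℙ ℂ (Fin 3 → ℂ))} {m : ℕ}
    {F : MvPolynomial (Fin 3) ℂ} (hF : F ∈ symbolicPower Z m) (k : ℕ) :
    F ^ k ∈ symbolicPower Z (k * m) :=
  fun P hP v hv hvP => (hF P hP v hv hvP).pow k

theorem initialDegree_eq {S : Set (MvPolynomial (Fin 3) ℂ)} {t : ℕ} {F : MvPolynomial (Fin 3) ℂ}
    (hF : F ∈ S) (hF₀ : F ≠ 0) (hFt : F.IsHomogeneous t)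
    (hmin : ∀ G ∈ S, G ≠ 0 → ∀ d, G.IsHomogeneous d → t ≤ d) : initialDegree S = t :=
  le_antisymm (Nat.sInf_le ⟨F, hF, hF₀, hFt⟩)
    (le_csInf ⟨t, F, hF, hF₀, hFt⟩ fun d ⟨G, hG, hG₀, hGd⟩ => hmin G hG hG₀ d hGd)

/-- Configuration `H(6,9)`: six points of `ℙ²` consisting of the three vertices `V₁, V₂, V₃` of
a triangle formed by three distinct non-concurrent lines `M₁, M₂, M₃`, together with one
additional point `Dᵢ` on each side `Mᵢ`, distinct from the vertices, such that the only
collinear triples among the six points lie on the sides of the triangle. Then `α̂(I) = 9/4` and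
the first differences of the initial sequence of `I` are periodic with period `(3,2,2,2)`. -/
theorem H6_9 (M₁ M₂ M₃ : MvPolynomial (Fin 3) ℂ)
    (hM₁ : IsLine M₁) (hM₂ : IsLine M₂) (hM₃ : IsLine M₃)
    (hd₁₂ : {x | MemLine M₁ x} ≠ {x | MemLine M₂ x})
    (hd₁₃ : {x | MemLine M₁ x} ≠ {x | MemLine M₃ x})
    (hd₂₃ : {x | MemLine M₂ x} ≠ {x | MemLine M₃ x})
    (hconc : ¬ ∃ x : ℙ ℂ (Fin 3 → ℂ), MemLine M₁ x ∧ MemLine M₂ x ∧ MemLine M₃ x)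
    (V₁ V₂ V₃ D₁ D₂ D₃ : ℙ ℂ (Fin 3 → ℂ))
    (hV₁ : MemLine M₂ V₁ ∧ MemLine M₃ V₁)
    (hV₂ : MemLine M₁ V₂ ∧ MemLine M₃ V₂)
    (hV₃ : MemLine M₁ V₃ ∧ MemLine M₂ V₃)
    (hD₁ : MemLine M₁ D₁) (hD₂ : MemLine M₂ D₂) (hD₃ : MemLine M₃ D₃)
    (hD₁V : D₁ ≠ V₁ ∧ D₁ ≠ V₂ ∧ D₁ ≠ V₃)
    (hD₂V : D₂ ≠ V₁ ∧ D₂ ≠ V₂ ∧ D₂ ≠ V₃)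
    (hD₃V : D₃ ≠ V₁ ∧ D₃ ≠ V₂ ∧ D₃ ≠ V₃)
    (Z : Set (ℙ ℂ (Fin 3 → ℂ)))
    (hZ : Z = {V₁, V₂, V₃, D₁, D₂, D₃}) (hcard : Z.ncard = 6)
    (htriples : ∀ X Y W, X ∈ Z → Y ∈ Z → W ∈ Z → X ≠ Y → X ≠ W → Y ≠ W → Collin X Y W →
      ((MemLine M₁ X ∧ MemLine M₁ Y ∧ MemLine M₁ W) ∨
       (MemLine M₂ X ∧ MemLine M₂ Y ∧ MemLine M₂ W) ∨
       (MemLine M₃ X ∧ MemLine M₃ Y ∧ MemLine M₃ W))) :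
    waldschmidt Z = 9 / 4 ∧
    ∀ k : ℕ,
      initialDegree (symbolicPower Z (4 * k + 1)) = 9 * k + 3 ∧
      initialDegree (symbolicPower Z (4 * k + 2)) = 9 * k + 5 ∧
      initialDegree (symbolicPower Z (4 * k + 3)) = 9 * k + 7 ∧
      initialDegree (symbolicPower Z (4 * k + 4)) = 9 * k + 9 := by
  have hV₁M : ¬ MemLine M₁ V₁ := fun h => hconc ⟨V₁, h, hV₁.1, hV₁.2⟩
  have hV₂M : ¬ MemLine M₂ V₂ := fun h => hconc ⟨V₂, hV₂.1, h, hV₂.2⟩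
  have hV₃M : ¬ MemLine M₃ V₃ := fun h => hconc ⟨V₃, hV₃.1, hV₃.2, h⟩
  have hV₁₂ : V₁ ≠ V₂ := fun h => hV₁M (h ▸ hV₂.1)
  have hV₂₃ : V₂ ≠ V₃ := fun h => hV₂M (h ▸ hV₃.2)
  have hD₁M₂ : ¬ MemLine M₂ D₁ := fun h =>
    hV₂M (MemLine.of_two_points hM₁ hM₂ hD₁V.2.2 hD₁ hV₃.1 hV₂.1 h hV₃.2)
  have hD₁M₃ : ¬ MemLine M₃ D₁ := fun h =>
    hV₃M (MemLine.of_two_points hM₁ hM₃ hD₁V.2.1 hD₁ hV₂.1 hV₃.1 h hV₂.2)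
  have hD₂M₁ : ¬ MemLine M₁ D₂ := fun h =>
    hV₁M (MemLine.of_two_points hM₂ hM₁ hD₂V.2.2 hD₂ hV₃.2 hV₁.1 h hV₃.1)
  have hD₂M₃ : ¬ MemLine M₃ D₂ := fun h =>
    hV₃M (MemLine.of_two_points hM₂ hM₃ hD₂V.1 hD₂ hV₁.1 hV₃.2 h hV₁.2)
  have hD₃M₁ : ¬ MemLine M₁ D₃ := fun h =>
    hV₁M (MemLine.of_two_points hM₃ hM₁ hD₃V.2.1 hD₃ hV₂.2 hV₁.2 h hV₂.1)
  have hD₃M₂ : ¬ MemLine M₂ D₃ := fun h =>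
    hV₂M (MemLine.of_two_points hM₃ hM₂ hD₃V.1 hD₃ hV₁.2 hV₂.2 h hV₁.1)
  have hD₁₂ : D₁ ≠ D₂ := fun h => hD₁M₂ (h ▸ hD₂)
  have hD₁₃ : D₁ ≠ D₃ := fun h => hD₁M₃ (h ▸ hD₃)
  have hD₂₃ : D₂ ≠ D₃ := fun h => hD₂M₃ (h ▸ hD₃)
  obtain ⟨N₁, hN₁, hN₁D₂, hN₁D₃⟩ := exists_line_through hD₂₃
  obtain ⟨N₂, hN₂, hN₂D₁, hN₂D₃⟩ := exists_line_through hD₁₃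
  obtain ⟨N₃, hN₃, hN₃D₁, hN₃D₂⟩ := exists_line_through hD₁₂
  have hZV₁ : V₁ ∈ Z := by simp [hZ]
  have hZV₂ : V₂ ∈ Z := by simp [hZ]
  have hZV₃ : V₃ ∈ Z := by simp [hZ]
  have hZD₁ : D₁ ∈ Z := by simp [hZ]
  have hZD₂ : D₂ ∈ Z := by simp [hZ]
  have hZD₃ : D₃ ∈ Z := by simp [hZ]
  have hN₁off : ∀ X ∈ Z, D₂ ≠ X → D₃ ≠ X → ¬ MemLine N₁ X := fun X hX h₂ h₃ h => by
    have := htriples D₂ D₃ X hZD₂ hZD₃ hX hD₂₃ h₂ h₃ ⟨N₁, hN₁, hN₁D₂, hN₁D₃, h⟩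
    tauto
  have hN₃off : ∀ X ∈ Z, D₁ ≠ X → D₂ ≠ X → ¬ MemLine N₃ X := fun X hX h₁ h₂ h => by
    have := htriples D₁ D₂ X hZD₁ hZD₂ hX hD₁₂ h₁ h₂ ⟨N₃, hN₃, hN₃D₁, hN₃D₂, h⟩
    tauto
  have hlower : ∀ {m d : ℕ} {F : MvPolynomial (Fin 3) ℂ}, F ∈ symbolicPower Z m → F ≠ 0 →
      F.IsHomogeneous d → 9 * m ≤ 4 * d := by
    intro m d F hF hF₀ hFd
    have := weighted_orders_le_degree hM₁ hM₃ hN₁ hN₃ hV₁₂ hV₂₃ hD₁V.2.1 hD₁V.2.2 hD₃V.1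
      hD₃V.2.1 hD₁₂ hD₂₃ ⟨hV₂.1, hV₃.1, hD₁⟩ ⟨hV₁M, hD₂M₁, hD₃M₁⟩ ⟨hV₁.2, hV₂.2, hD₃⟩
      ⟨hV₃M, hD₁M₃, hD₂M₃⟩ ⟨hN₁D₂, hN₁D₃⟩
      ⟨hN₁off _ hZV₁ hD₂V.1 hD₃V.1, hN₁off _ hZV₂ hD₂V.2.1 hD₃V.2.1,
        hN₁off _ hZV₃ hD₂V.2.2 hD₃V.2.2, hN₁off _ hZD₁ hD₁₂.symm hD₁₃.symm⟩ ⟨hN₃D₁, hN₃D₂⟩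
      ⟨hN₃off _ hZV₁ hD₁V.1 hD₂V.1, hN₃off _ hZV₂ hD₁V.2.1 hD₂V.2.1,
        hN₃off _ hZV₃ hD₁V.2.2 hD₂V.2.2, hN₃off _ hZD₃ hD₁₃ hD₂₃⟩ hFd hF₀
      (hasOrderAt_of_mem_symbolicPower hF hZV₁) (hasOrderAt_of_mem_symbolicPower hF hZV₂)
      (hasOrderAt_of_mem_symbolicPower hF hZV₃) (hasOrderAt_of_mem_symbolicPower hF hZD₁)
      (hasOrderAt_of_mem_symbolicPower hF hZD₂) (hasOrderAt_of_mem_symbolicPower hF hZD₃)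
    omega
  -- Orders of vanishing of the triangle of sides and of the triangle on the additional points.
  let T := M₁ * M₂ * M₃
  have hT₀ : T ≠ 0 := mul_ne_zero (mul_ne_zero hM₁.1 hM₂.1) hM₃.1
  have hT : T.IsHomogeneous 3 := (hM₁.2.mul hM₂.2).mul hM₃.2
  have hmem : ∀ {m : ℕ} {F : MvPolynomial (Fin 3) ℂ},
      (∀ v hv, (Projectivization.mk ℂ v hv = V₁ ∨ Projectivization.mk ℂ v hv = V₂ ∨
        Projectivization.mk ℂ v hv = V₃ ∨ Projectivization.mk ℂ v hv = D₁ ∨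
        Projectivization.mk ℂ v hv = D₂ ∨ Projectivization.mk ℂ v hv = D₃) →
        VanishesToOrder m F v) → F ∈ symbolicPower Z m := by
    intro m F h P hP v hv hvP
    refine h v hv ?_
    subst hvP
    simpa [hZ] using hP
  have z : ∀ (F : MvPolynomial (Fin 3) ℂ) (v : Fin 3 → ℂ), VanishesToOrder 0 F v :=
    VanishesToOrder.zero
  have o : ∀ {L : MvPolynomial (Fin 3) ℂ} {P : ℙ ℂ (Fin 3 → ℂ)} {v : Fin 3 → ℂ} {hv : v ≠ 0},
      MemLine L P → Projectivization.mk ℂ v hv = P → VanishesToOrder 1 L v :=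
    fun h hvP => VanishesToOrder.one (h _ _ hvP)
  have hT₁ : T ∈ symbolicPower Z 1 := hmem fun v hv h => by
    rcases h with h | h | h | h | h | h
    · exact ((z M₁ v).mul (o hV₁.1 h)).mul (z M₃ v)
    · exact ((o hV₂.1 h).mul (z M₂ v)).mul (z M₃ v)
    · exact ((o hV₃.1 h).mul (z M₂ v)).mul (z M₃ v)
    · exact ((o hD₁ h).mul (z M₂ v)).mul (z M₃ v)
    · exact ((z M₁ v).mul (o hD₂ h)).mul (z M₃ v)
    · exact ((z M₁ v).mul (z M₂ v)).mul (o hD₃ h)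
  have hTV : ∀ v hv, (Projectivization.mk ℂ v hv = V₁ ∨ Projectivization.mk ℂ v hv = V₂ ∨
      Projectivization.mk ℂ v hv = V₃) → VanishesToOrder 2 T v := by
    rintro v hv (h | h | h)
    · exact ((z M₁ v).mul (o hV₁.1 h)).mul (o hV₁.2 h)
    · exact ((o hV₂.1 h).mul (z M₂ v)).mul (o hV₂.2 h)
    · exact ((o hV₃.1 h).mul (o hV₃.2 h)).mul (z M₃ v)
  have hT₂ : T * (N₂ * N₃) ∈ symbolicPower Z 2 := hmem fun v hv h => by
    rcases h with h | h | h | h | h | h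
    · exact (hTV v hv (.inl h)).mul (z _ v)
    · exact (hTV v hv (.inr (.inl h))).mul (z _ v)
    · exact (hTV v hv (.inr (.inr h))).mul (z _ v)
    · exact (hT₁ _ hZD₁ v hv h).mul ((o hN₂D₁ h).mul (z _ v))
    · exact (hT₁ _ hZD₂ v hv h).mul ((z _ v).mul (o hN₃D₂ h))
    · exact (hT₁ _ hZD₃ v hv h).mul ((o hN₂D₃ h).mul (z _ v))
  have hT₃ : T * (M₁ * M₃) * (N₁ * N₃) ∈ symbolicPower Z 3 := hmem fun v hv h => by
    rcases h with h | h | h | h | h | h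
    · exact ((hTV v hv (.inl h)).mul ((z _ v).mul (o hV₁.2 h))).mul (z _ v)
    · exact ((hTV v hv (.inr (.inl h))).mul ((z _ v).mul (o hV₂.2 h))).mul (z _ v)
    · exact ((hTV v hv (.inr (.inr h))).mul ((o hV₃.1 h).mul (z _ v))).mul (z _ v)
    · exact ((hT₁ _ hZD₁ v hv h).mul ((o hD₁ h).mul (z _ v))).mul ((z _ v).mul (o hN₃D₁ h))
    · exact ((hT₁ _ hZD₂ v hv h).mul (z _ v)).mul ((o hN₁D₂ h).mul (o hN₃D₂ h))
    · exact ((hT₁ _ hZD₃ v hv h).mul ((z _ v).mul (o hD₃ h))).mul ((o hN₁D₃ h).mul (z _ v))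
  have hT₄ : T * T * (N₁ * N₂ * N₃) ∈ symbolicPower Z 4 := hmem fun v hv h => by
    rcases h with h | h | h | h | h | h
    · exact ((hTV v hv (.inl h)).mul (hTV v hv (.inl h))).mul (z _ v)
    · exact ((hTV v hv (.inr (.inl h))).mul (hTV v hv (.inr (.inl h)))).mul (z _ v)
    · exact ((hTV v hv (.inr (.inr h))).mul (hTV v hv (.inr (.inr h)))).mul (z _ v)
    · exact ((hT₁ _ hZD₁ v hv h).mul (hT₁ _ hZD₁ v hv h)).mul
        (((z _ v).mul (o hN₂D₁ h)).mul (o hN₃D₁ h))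
    · exact ((hT₁ _ hZD₂ v hv h).mul (hT₁ _ hZD₂ v hv h)).mul
        (((o hN₁D₂ h).mul (z _ v)).mul (o hN₃D₂ h))
    · exact ((hT₁ _ hZD₃ v hv h).mul (hT₁ _ hZD₃ v hv h)).mul
        (((o hN₁D₃ h).mul (o hN₂D₃ h)).mul (z _ v))
  have hN₀ : N₁ * N₂ * N₃ ≠ 0 := mul_ne_zero (mul_ne_zero hN₁.1 hN₂.1) hN₃.1
  have hdegree : ∀ {j t : ℕ} {F : MvPolynomial (Fin 3) ℂ} (k : ℕ), F ∈ symbolicPower Z j →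
      F ≠ 0 → F.IsHomogeneous t → 4 * t < 9 * j + 4 →
      initialDegree (symbolicPower Z (4 * k + j)) = 9 * k + t := by
    intro j t F k hF hF₀ hFt ht
    refine initialDegree_eq (F := (T * T * (N₁ * N₂ * N₃)) ^ k * F) ?_
      (mul_ne_zero (pow_ne_zero _ (mul_ne_zero (mul_ne_zero hT₀ hT₀) hN₀)) hF₀)
      ((((hT.mul hT).mul ((hN₁.2.mul hN₂.2).mul hN₃.2)).pow k).mul hFt) fun G hG hG₀ d hGd => ?_
    · rw [mul_comm 4 k]
      exact mul_mem_symbolicPower (pow_mem_symbolicPower hT₄ k) hF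
    · have := hlower hG hG₀ hGd
      omega
  have hfour : ∀ k : ℕ, initialDegree (symbolicPower Z (4 * k + 4)) = 9 * k + 9 := fun k =>
    hdegree k hT₄ (mul_ne_zero (mul_ne_zero hT₀ hT₀) hN₀)
      ((hT.mul hT).mul ((hN₁.2.mul hN₂.2).mul hN₃.2)) (by norm_num)
  refine ⟨le_antisymm ?_ (le_ciInf fun m => ?_), fun k =>
    ⟨hdegree k hT₁ hT₀ hT (by norm_num),
      hdegree k hT₂ (mul_ne_zero hT₀ (mul_ne_zero hN₂.1 hN₃.1)) (hT.mul (hN₂.2.mul hN₃.2))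
        (by norm_num),
      hdegree k hT₃ (mul_ne_zero (mul_ne_zero hT₀ (mul_ne_zero hM₁.1 hM₃.1))
        (mul_ne_zero hN₁.1 hN₃.1)) ((hT.mul (hM₁.2.mul hM₃.2)).mul (hN₁.2.mul hN₃.2))
        (by norm_num),
      hfour k⟩⟩
  · have hbdd : BddBelow (Set.range fun m : ℕ+ =>
        (initialDegree (symbolicPower Z (m : ℕ)) : ℝ) / ((m : ℕ) : ℝ)) :=
      ⟨0, by rintro _ ⟨m, rfl⟩; positivity⟩
    have h₄ : initialDegree (symbolicPower Z 4) = 9 := hfour 0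
    refine (ciInf_le hbdd 4).trans (le_of_eq ?_)
    simp [h₄]
  · have hne : {t | ∃ F ∈ symbolicPower Z (m : ℕ), F ≠ 0 ∧ F.IsHomogeneous t}.Nonempty :=
      ⟨_, T ^ (m : ℕ), by simpa using pow_mem_symbolicPower hT₁ (m : ℕ), pow_ne_zero _ hT₀,
        hT.pow _⟩
    obtain ⟨F, hF, hF₀, hFd⟩ := Nat.sInf_mem hne
    have hle : 9 * (m : ℕ) ≤ 4 * initialDegree (symbolicPower Z (m : ℕ)) := hlower hF hF₀ hFd
    have hm : (0 : ℝ) < ((m : ℕ) : ℝ) := by exact_mod_cast m.pos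
    rw [div_le_div_iff₀ (by norm_num) hm]
    exact_mod_cast (mul_comm 4 (initialDegree (symbolicPower Z (m : ℕ)))) ▸ hle
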